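/- Let K be a field and let P₁ Q₁ R₁ S₁ and P₂ Q₂ R₂ S₂ be quadrangles in the projective plane ℙ K (Fin 3 → K), perspective from a point O. Assume general position: all homologous vertex pairs are distinct (P₁ ≠ P₂, Q₁ ≠ Q₂, R₁ ≠ R₂, S₁ ≠ S₂) and all six homologous side lines are distinct (Q₁R₁ ≠ Q₂R₂, R₁P₁ ≠ R₂P₂, P₁Q₁ ≠ P₂Q₂, S₁P₁ ≠ S₂P₂, S₁Q₁ ≠ S₂Q₂, S₁R₁ ≠ S₂R₂ as lines). Suppose that for some points C₁ collinear with S₁, R₁ and with P₁, Q₁ and C₂ collinear with S₂, R₂ and with P₂, Q₂, the triple (O, C₁, C₂) is collinear. Then O is collinear with each of the other homologous pairs of diagonal points: for all points A₁ collinear with S₁, P₁ and with Q₁, R₁ and A₂ collinear with S₂, P₂ and with Q₂, R₂, the triple (O, A₁, A₂) is collinear; and for all points B₁ collinear with S₁, Q₁ and with R₁, P₁ and B₂ collinear with S₂, Q₂ and with R₂, P₂, the triple (O, B₁, B₂) is collinear. -/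

import Mathlib

open Projectivization

/-- Three points of the projective plane are collinear if their representative
vectors are linearly dependent. -/
def Col (K : Type*) [Field K] (a b c : Projectivization K (Fin 3 → K)) : Prop :=
  ¬ Projectivization.Independent ![a, b, c]

/-- A quadrangle: four points, no three of which are collinear. -/
def IsQuadrangle (K : Type*) [Field K] (P Q R S : Projectivization K (Fin 3 → K)) : Prop :=
  ¬ Col K P Q R ∧ ¬ Col K P Q S ∧ ¬ Col K P R S ∧ ¬ Col K Q R S

/-- The line through two points, as a submodule of `K³`. -/
def line {K : Type*} [Field K] (a b : Projectivization K (Fin 3 → K)) :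
    Submodule K (Fin 3 → K) :=
  a.submodule ⊔ b.submodule

/-- explicit 3x3 determinant -/
def D3 {K : Type*} [Field K] (u v w : Fin 3 → K) : K :=
  u 0 * (v 1 * w 2 - v 2 * w 1) - u 1 * (v 0 * w 2 - v 2 * w 0) + u 2 * (v 0 * w 1 - v 1 * w 0)

theorem col_iff {K : Type*} [Field K] (a b c : Projectivization K (Fin 3 → K)) :
    Col K a b c ↔ D3 a.rep b.rep c.rep = 0 := by
  unfold Col
  rw [Projectivization.independent_iff]
  have h : (Projectivization.rep ∘ ![a, b, c]) = (Matrix.of ![a.rep, b.rep, c.rep]).row := by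
    funext i
    fin_cases i <;> rfl
  rw [h, Matrix.linearIndependent_rows_iff_isUnit, Matrix.isUnit_iff_isUnit_det, isUnit_iff_ne_zero,
    not_not, Matrix.det_fin_three]
  simp [D3]
  constructor <;> intro h <;> linear_combination h

theorem cramer3 {K : Type*} [Field K] (a b c v : Fin 3 → K) (h : D3 a b c ≠ 0) :
    v = (D3 v b c / D3 a b c) • a + (D3 a v c / D3 a b c) • b + (D3 a b v / D3 a b c) • c := by
  have h2 : D3 a b c • v = D3 v b c • a + D3 a v c • b + D3 a b v • c := by
    funext i
    fin_cases i <;> simp [D3] <;> ring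
  have h3 : v = (D3 a b c)⁻¹ • (D3 a b c • v) := by
    rw [smul_smul, inv_mul_cancel₀ h, one_smul]
  rw [h2] at h3
  conv_lhs => rw [h3]
  simp only [smul_add, smul_smul, div_eq_inv_mul]

/-- Two independent vectors extend to a basis. -/
theorem extend2 {K : Type*} [Field K] {a b : Projectivization K (Fin 3 → K)} (h : a ≠ b) :
    ∃ t : Fin 3 → K, D3 a.rep b.rep t ≠ 0 := by
  by_contra! H
  apply h
  have h0 := H ![1, 0, 0]
  have h1 := H ![0, 1, 0]
  have h2 := H ![0, 0, 1]
  simp [D3] at h0 h1 h2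
  have ha := a.rep_nonzero
  have hb := b.rep_nonzero
  rw [← a.mk_rep, ← b.mk_rep, Projectivization.mk_eq_mk_iff']
  have : ∃ i, b.rep i ≠ 0 := by
    by_contra! hh
    exact hb (funext hh)
  obtain ⟨i, hi⟩ := this
  refine ⟨a.rep i / b.rep i, ?_⟩
  funext j
  simp only [Pi.smul_apply, smul_eq_mul]
  field_simp
  fin_cases i <;> fin_cases j <;> simp <;> grind

theorem comb {K : Type*} [Field K] {a b c : Projectivization K (Fin 3 → K)} (h : a ≠ b)
    (hc : Col K a b c) : ∃ x y : K, c.rep = x • a.rep + y • b.rep := by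
  obtain ⟨t, ht⟩ := extend2 h
  rw [col_iff] at hc
  have := cramer3 a.rep b.rep t c.rep ht
  rw [hc] at this
  exact ⟨_, _, by simpa using this⟩

section
variable {K : Type*} [Field K] {a b c d e : Projectivization K (Fin 3 → K)}

theorem col_swap (h : Col K a b c) : Col K b a c := by
  rw [col_iff] at *
  unfold D3 at *
  linear_combination -h

theorem col_rot (h : Col K a b c) : Col K b c a := by
  rw [col_iff] at *
  unfold D3 at *
  linear_combination h

theorem col_self : Col K a a b := by
  rw [col_iff]
  unfold D3
  ring

theorem col_trans (h : a ≠ b) (hc : Col K a b c) (hd : Col K a b d) (he : Col K a b e) :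
    Col K c d e := by
  obtain ⟨x, y, h1⟩ := comb h hc
  obtain ⟨z, w, h2⟩ := comb h hd
  obtain ⟨u, v, h3⟩ := comb h he
  rw [col_iff, h1, h2, h3]
  simp [D3]
  ring

theorem col_fst : Col K a b a := by
  rw [col_iff]
  unfold D3
  ring

theorem col_snd : Col K a b b := by
  rw [col_iff]
  unfold D3
  ring

theorem line_le (h : a ≠ b) (hc : Col K a b c) (hd : Col K a b d) : line c d ≤ line a b := by
  have key : ∀ c : Projectivization K (Fin 3 → K), Col K a b c → c.submodule ≤ line a b := by
    intro c hc
    obtain ⟨x, y, h1⟩ := comb h hc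
    rw [Projectivization.submodule_eq, Submodule.span_singleton_le_iff_mem, h1]
    unfold line
    rw [Projectivization.submodule_eq, Projectivization.submodule_eq]
    exact Submodule.add_mem_sup (Submodule.smul_mem _ _ (Submodule.mem_span_singleton_self _))
      (Submodule.smul_mem _ _ (Submodule.mem_span_singleton_self _))
  exact sup_le (key c hc) (key d hd)

theorem line_eq (h : a ≠ b) (h' : c ≠ d) (hc : Col K a b c) (hd : Col K a b d) :
    line a b = line c d :=
  le_antisymm (line_le h' (col_trans h hc hd col_fst) (col_trans h hc hd col_snd))
    (line_le h hc hd)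
end

theorem vert {K : Type*} [Field K]
    {P₁ Q₁ R₁ S₁ P₂ Q₂ R₂ S₂ O C₁ C₂ : Projectivization K (Fin 3 → K)}
    (n1 : P₁ ≠ Q₁) (n2 : P₂ ≠ Q₂)
    (hq1 : ¬ Col K S₁ R₁ P₁) (hq2 : ¬ Col K S₂ R₂ Q₂)
    (hperspQ : Col K O Q₁ Q₂) (hPQ : line P₁ Q₁ ≠ line P₂ Q₂)
    (hC₁SR : Col K S₁ R₁ C₁) (hC₁PQ : Col K P₁ Q₁ C₁)
    (hC₂SR : Col K S₂ R₂ C₂) (hC₂PQ : Col K P₂ Q₂ C₂)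
    (hOC : Col K O C₁ C₂) : O ≠ P₁ := by
  rintro rfl
  have h1 : O ≠ C₁ := by
    rintro rfl
    exact hq1 hC₁SR
  have h2 : Q₂ ≠ C₂ := by
    rintro rfl
    exact hq2 hC₂SR
  have h3 : Col K O Q₁ C₂ := col_trans h1 col_fst (col_rot (col_swap hC₁PQ)) hOC
  apply hPQ
  apply line_eq n1 n2 _ hperspQ
  have h4 : Col K Q₂ C₂ P₂ := col_rot hC₂PQ
  exact col_trans h2 (col_trans n1 hperspQ h3 col_fst) (col_trans n1 hperspQ h3 col_snd) h4

theorem side {K : Type*} [Field K] {P₁ Q₁ P₂ Q₂ O : Projectivization K (Fin 3 → K)}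
    (n1 : P₁ ≠ Q₁) (n2 : P₂ ≠ Q₂) (hP : Col K O P₁ P₂) (hQ : Col K O Q₁ Q₂)
    (hPQ : line P₁ Q₁ ≠ line P₂ Q₂) (oP : O ≠ P₁) (oQ : O ≠ Q₁) : ¬ Col K O P₁ Q₁ := by
  intro h
  have h' : Col K P₁ Q₁ O := col_rot h
  apply hPQ
  apply line_eq n1 n2
  · exact col_trans oP (col_snd) h hP
  · exact col_trans oQ (col_rot (col_swap h)) col_snd hQ

/-- Intersection of the lines `ab` and `cd` when `d = xa + yb + zc`. -/
theorem meet {K : Type*} [Field K] {a b c d v : Fin 3 → K} {x y z : K} (h : D3 a b c ≠ 0)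
    (hd : d = x • a + y • b + z • c) (hx : x ≠ 0) (h1 : D3 a b v = 0) (h2 : D3 c d v = 0) :
    ∃ k : K, v = k • (x • a + y • b) := by
  have hv := cramer3 a b c v h
  rw [h1] at hv
  generalize D3 v b c / D3 a b c = u at hv
  generalize D3 a v c / D3 a b c = w at hv
  simp only [zero_div, zero_smul, add_zero] at hv
  have h3 : (x * w - y * u) * D3 a b c = 0 := by
    rw [← h2, hd, hv]
    simp [D3]
    ring
  have h4 : x * w - y * u = 0 := (mul_eq_zero.mp h3).resolve_right h
  refine ⟨u / x, ?_⟩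
  have h5 : w = u / x * y := by
    field_simp
    linear_combination h4
  have h6 : u = u / x * x := by field_simp
  rw [hv, smul_add, smul_smul, smul_smul, ← h5, ← h6]

theorem core {K : Type*} [Field K]
    {p q r s p' q' r' s' o c c' : Fin 3 → K} {α β γ δ a b g d x y z x' y' z' : K}
    (h : D3 p q r ≠ 0) (h' : D3 p' q' r' ≠ 0)
    (hs : s = x • p + y • q + z • r) (hs' : s' = x' • p' + y' • q' + z' • r')
    (hp : p' = α • p + a • o) (hq : q' = β • q + b • o)
    (hr : r' = γ • r + g • o) (hsd : s' = δ • s + d • o)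
    (hx : x ≠ 0) (hx' : x' ≠ 0)
    (hc0 : c ≠ 0) (hc0' : c' ≠ 0)
    (opq : D3 o p q ≠ 0) (ors : D3 o r s ≠ 0) (opr : D3 o p r ≠ 0)
    (hc1 : D3 p q c = 0) (hc2 : D3 r s c = 0)
    (hc1' : D3 p' q' c' = 0) (hc2' : D3 r' s' c' = 0) (hoc : D3 o c c' = 0) :
    x' * α = δ * x ∧ y' * β = δ * y ∧ z' * γ = δ * z := by
  obtain ⟨k, hk⟩ := meet h hs hx hc1 hc2
  obtain ⟨k', hk'⟩ := meet h' hs' hx' hc1' hc2'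
  have k0 : k ≠ 0 := by
    rintro rfl
    simp at hk
    exact hc0 hk
  have k0' : k' ≠ 0 := by
    rintro rfl
    simp at hk'
    exact hc0' hk'
  have e1 : (k * k' * (x * (y' * β) - y * (x' * α))) * D3 o p q = 0 := by
    rw [← hoc, hk, hk', hp, hq]
    simp [D3]
    ring
  have e2 : x * (y' * β) - y * (x' * α) = 0 := by
    have := (mul_eq_zero.mp e1).resolve_right opq
    exact (mul_eq_zero.mp this).resolve_left (mul_ne_zero k0 k0')
  have e3 : D3 o r s' = δ * D3 o r s := by
    rw [hsd]
    simp [D3]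
    ring
  have e4 : D3 o r s' = x' * α * D3 o r p + y' * β * D3 o r q := by
    rw [hs', hp, hq, hr]
    simp [D3]
    ring
  have e5 : D3 o r s = x * D3 o r p + y * D3 o r q := by
    rw [hs]
    simp [D3]
    ring
  have e6 : (x' * α - δ * x) * D3 o r s = 0 := by
    linear_combination (x' * α) * e5 + x * e3 - x * e4 - D3 o r q * e2
  have e7 : x' * α - δ * x = 0 := (mul_eq_zero.mp e6).resolve_right ors
  have e8 : y' * β - δ * y = 0 := by
    have : x * (y' * β - δ * y) = 0 := by linear_combination e2 + y * e7
    exact (mul_eq_zero.mp this).resolve_left hx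
  have f3 : D3 o p s' = δ * (y * D3 o p q + z * D3 o p r) := by
    rw [hsd, hs]
    simp [D3]
    ring
  have f4 : D3 o p s' = y' * β * D3 o p q + z' * γ * D3 o p r := by
    rw [hs', hp, hq, hr]
    simp [D3]
    ring
  have f5 : (z' * γ - δ * z) * D3 o p r = 0 := by
    linear_combination f3 - f4 - D3 o p q * e8
  have f6 := (mul_eq_zero.mp f5).resolve_right opr
  exact ⟨sub_eq_zero.mp e7, sub_eq_zero.mp e8, sub_eq_zero.mp f6⟩

theorem fin_step {K : Type*} [Field K]
    {p q r s p' q' r' s' o v v' : Fin 3 → K} {β γ δ b g x y z x' y' z' : K}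
    (h : D3 q r p ≠ 0) (h' : D3 q' r' p' ≠ 0)
    (hs : s = y • q + z • r + x • p) (hs' : s' = y' • q' + z' • r' + x' • p')
    (hq : q' = β • q + b • o) (hr : r' = γ • r + g • o)
    (hy : y ≠ 0) (hy' : y' ≠ 0) (e : y' * β = δ * y) (f : z' * γ = δ * z)
    (h1 : D3 q r v = 0) (h2 : D3 p s v = 0) (h1' : D3 q' r' v' = 0) (h2' : D3 p' s' v' = 0) :
    D3 o v v' = 0 := by
  obtain ⟨k, hk⟩ := meet h hs hy h1 h2
  obtain ⟨k', hk'⟩ := meet h' hs' hy' h1' h2'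
  have : D3 o v v' = k * k' * (y * (z' * γ) - z * (y' * β)) * D3 o q r := by
    rw [hk, hk', hq, hr]
    simp [D3]
    ring
  rw [this, e, f]
  ring

theorem col_ne {K : Type*} [Field K] {a b c : Projectivization K (Fin 3 → K)}
    (h : ¬ Col K a b c) : a ≠ b ∧ b ≠ c ∧ c ≠ a := by
  refine ⟨?_, ?_, ?_⟩ <;> rintro rfl <;> apply h
  · exact col_self
  · exact col_snd
  · exact col_fst

theorem expand {K : Type*} [Field K] {P Q R S : Projectivization K (Fin 3 → K)}
    (h : IsQuadrangle K P Q R S) : ∃ x y z : K, x ≠ 0 ∧ y ≠ 0 ∧ z ≠ 0 ∧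
      S.rep = x • P.rep + y • Q.rep + z • R.rep := by
  obtain ⟨h1, h2, h3, h4⟩ := h
  rw [col_iff] at *
  refine ⟨_, _, _, ?_, ?_, ?_, cramer3 P.rep Q.rep R.rep S.rep h1⟩
  · refine div_ne_zero (fun h => h4 ?_) h1
    unfold D3 at *
    linear_combination h
  · refine div_ne_zero (fun h => h3 ?_) h1
    unfold D3 at *
    linear_combination -h
  · exact div_ne_zero h2 h1

theorem one_diagonal_pair_collinear_implies_all
    {K : Type*} [Field K]
    (P₁ Q₁ R₁ S₁ P₂ Q₂ R₂ S₂ O : Projectivization K (Fin 3 → K))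
    (hq1 : IsQuadrangle K P₁ Q₁ R₁ S₁)
    (hq2 : IsQuadrangle K P₂ Q₂ R₂ S₂)
    (hperspP : Col K O P₁ P₂) (hperspQ : Col K O Q₁ Q₂)
    (hperspR : Col K O R₁ R₂) (hperspS : Col K O S₁ S₂)
    (hPP : P₁ ≠ P₂) (hQQ : Q₁ ≠ Q₂) (hRR : R₁ ≠ R₂) (hSS : S₁ ≠ S₂)
    (hQR : line Q₁ R₁ ≠ line Q₂ R₂) (hRP : line R₁ P₁ ≠ line R₂ P₂)
    (hPQ : line P₁ Q₁ ≠ line P₂ Q₂) (hSP : line S₁ P₁ ≠ line S₂ P₂)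
    (hSQ : line S₁ Q₁ ≠ line S₂ Q₂) (hSR : line S₁ R₁ ≠ line S₂ R₂)
    (C₁ C₂ : Projectivization K (Fin 3 → K))
    (hC₁SR : Col K S₁ R₁ C₁) (hC₁PQ : Col K P₁ Q₁ C₁)
    (hC₂SR : Col K S₂ R₂ C₂) (hC₂PQ : Col K P₂ Q₂ C₂)
    (hOC : Col K O C₁ C₂) :
    (∀ A₁ A₂ : Projectivization K (Fin 3 → K),
      Col K S₁ P₁ A₁ → Col K Q₁ R₁ A₁ → Col K S₂ P₂ A₂ → Col K Q₂ R₂ A₂ →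
      Col K O A₁ A₂) ∧
    (∀ B₁ B₂ : Projectivization K (Fin 3 → K),
      Col K S₁ Q₁ B₁ → Col K R₁ P₁ B₁ → Col K S₂ Q₂ B₂ → Col K R₂ P₂ B₂ →
      Col K O B₁ B₂) := by
  obtain ⟨x, y, z, hx, hy, hz, hs⟩ := expand hq1
  obtain ⟨x', y', z', hx', hy', hz', hs'⟩ := expand hq2
  obtain ⟨a1, a2, a3, a4⟩ := hq1
  obtain ⟨b1, b2, b3, b4⟩ := hq2
  have lc : ∀ a b : Projectivization K (Fin 3 → K), line a b = line b a :=
    fun a b => sup_comm _ _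
  have nP : O ≠ P₁ := vert (col_ne a1).1 (col_ne b1).1
    (fun h => a3 (col_swap (col_rot h)))
    (fun h => b4 (col_swap (col_rot h))) hperspQ hPQ hC₁SR hC₁PQ hC₂SR hC₂PQ hOC
  have nQ : O ≠ Q₁ := vert (col_ne a1).1.symm (col_ne b1).1.symm
    (fun h => a4 (col_swap (col_rot h))) (fun h => b3 (col_swap (col_rot h))) hperspP
    (by rwa [lc, lc Q₂]) hC₁SR (col_swap hC₁PQ) hC₂SR (col_swap hC₂PQ) hOC
  have nS : O ≠ S₁ := vert (col_ne a3).2.1.symm (col_ne b3).2.1.symm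
    a2 (fun h => b1 h) hperspR hSR hC₁PQ hC₁SR hC₂PQ hC₂SR hOC
  have nR : O ≠ R₁ := vert (col_ne a3).2.1 (col_ne b3).2.1
    a1 (fun h => b2 h) hperspS (by rwa [lc, lc R₂]) hC₁PQ (col_swap hC₁SR) hC₂PQ
      (col_swap hC₂SR) hOC
  have opq := side (col_ne a1).1 (col_ne b1).1 hperspP hperspQ hPQ nP nQ
  have ors := side (col_ne a3).2.1 (col_ne b3).2.1 hperspR hperspS
    (by rwa [lc, lc R₂]) nR nS
  have opr := side (col_ne a1).2.2.symm (col_ne b1).2.2.symm hperspP hperspR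
    (by rwa [lc, lc P₂]) nP nR
  obtain ⟨a, α, hp⟩ := comb nP hperspP
  obtain ⟨b, β, hq⟩ := comb nQ hperspQ
  obtain ⟨g, γ, hr⟩ := comb nR hperspR
  obtain ⟨d, δ, hsd⟩ := comb nS hperspS
  rw [add_comm] at hp hq hr hsd
  rw [col_iff] at a1 b1 opq ors opr hC₁PQ hC₂PQ hOC
  have hC₁ := (col_iff _ _ _).1 (col_swap hC₁SR)
  have hC₂ := (col_iff _ _ _).1 (col_swap hC₂SR)
  obtain ⟨e1, e2, e3⟩ := core a1 b1 hs hs' hp hq hr hsd hx hx' C₁.rep_nonzero C₂.rep_nonzero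
    opq ors opr hC₁PQ hC₁ hC₂PQ hC₂ hOC
  constructor
  · intro A₁ A₂ h1 h2 h3 h4
    have h1 := (col_iff _ _ _).1 (col_swap h1)
    have h3 := (col_iff _ _ _).1 (col_swap h3)
    rw [col_iff] at h2 h4 ⊢
    refine fin_step (p := P₁.rep) (p' := P₂.rep) (x := x) (x' := x') ?_ ?_ ?_ ?_ hq hr hy hy' e2 e3 h2 h1 h4 h3
    · intro h; apply a1; unfold D3 at *; linear_combination h
    · intro h; apply b1; unfold D3 at *; linear_combination h
    · rw [hs]; abel
    · rw [hs']; abel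
  · intro A₁ A₂ h1 h2 h3 h4
    have h1 := (col_iff _ _ _).1 (col_swap h1)
    have h3 := (col_iff _ _ _).1 (col_swap h3)
    rw [col_iff] at h2 h4 ⊢
    refine fin_step (p := Q₁.rep) (p' := Q₂.rep) (x := y) (x' := y') ?_ ?_ ?_ ?_ hr hp hz hz' e3 e1 h2 h1 h4 h3
    · intro h; apply a1; unfold D3 at *; linear_combination h
    · intro h; apply b1; unfold D3 at *; linear_combination h
    · rw [hs]; abel
    · rw [hs']; abel
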